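/- The explicit Latin square W of order 8 given in the context contains exactly 9 intercalates (Latin trades of size 4). -/

import Mathlib

/-- A Latin square of order `n`, represented as a function giving the entry in
row `i`, column `j`: every element occurs exactly once in each row and column. -/
def IsLatinSquare {n : ℕ} (L : Fin n → Fin n → Fin n) : Prop :=
  (∀ i, Function.Injective (L i)) ∧ (∀ j, Function.Injective fun i => L i j)

/-- The set of triples `(i, j; L i j)` of a square `L`. -/
def entries {n : ℕ} (L : Fin n → Fin n → Fin n) : Finset (Fin n × Fin n × Fin n) :=
  Finset.univ.image fun p : Fin n × Fin n => (p.1, p.2, L p.1 p.2)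

/-- `T` is a Latin trade in `L`: the (nonempty) set of entries of `L` in the positions
where `L` differs from some other Latin square `L'` of the same order. -/
def IsTrade {n : ℕ} (L : Fin n → Fin n → Fin n)
    (T : Finset (Fin n × Fin n × Fin n)) : Prop :=
  ∃ L' : Fin n → Fin n → Fin n, IsLatinSquare L' ∧ L' ≠ L ∧
    T = (Finset.univ.filter fun p : Fin n × Fin n => L p.1 p.2 ≠ L' p.1 p.2).image
          fun p => (p.1, p.2, L p.1 p.2)

/-- `U` is a uniquely completable set for `L`: `U ⊆ L` and `L` is the only
Latin square of order `n` containing `U`. -/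
def IsUC {n : ℕ} (L : Fin n → Fin n → Fin n)
    (U : Finset (Fin n × Fin n × Fin n)) : Prop :=
  U ⊆ entries L ∧
    ∀ L' : Fin n → Fin n → Fin n, IsLatinSquare L' → U ⊆ entries L' → L' = L

/-- `C` is a critical set of `L`: a uniquely completable set for `L`,
no proper subset of which is uniquely completable. -/
def IsCritical {n : ℕ} (L : Fin n → Fin n → Fin n)
    (C : Finset (Fin n × Fin n × Fin n)) : Prop :=
  IsUC L C ∧ ∀ C' ⊂ C, ¬ IsUC L C'

/-- `scs n`: the smallest size of a critical set in any Latin square of order `n`. -/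
noncomputable def scs (n : ℕ) : ℕ :=
  sInf {s | ∃ (L : Fin n → Fin n → Fin n) (C : Finset (Fin n × Fin n × Fin n)),
    IsLatinSquare L ∧ IsCritical L C ∧ C.card = s}

/-- `R(T)`: the number of distinct rows occurring in `T`. -/
def rowCount {n : ℕ} (T : Finset (Fin n × Fin n × Fin n)) : ℕ :=
  (T.image fun t => t.1).card

/-- `C(T)`: the number of distinct columns occurring in `T`. -/
def colCount {n : ℕ} (T : Finset (Fin n × Fin n × Fin n)) : ℕ :=
  (T.image fun t => t.2.1).card

/-- `E(T)`: the number of distinct elements occurring in `T`. -/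
def elemCount {n : ℕ} (T : Finset (Fin n × Fin n × Fin n)) : ℕ :=
  (T.image fun t => t.2.2).card

/-- The Latin square `W` (0-based encoding of the square with rows
(8,6,7,4,1,2,3,5), (7,3,2,8,5,4,1,6), (6,4,5,3,7,1,2,8), (2,5,3,1,8,6,4,7),
(5,8,1,2,6,3,7,4), (1,7,4,6,3,8,5,2), (3,2,8,5,4,7,6,1), (4,1,6,7,2,5,8,3)). -/
def W : Fin 8 → Fin 8 → Fin 8 :=
  ![![7, 5, 6, 3, 0, 1, 2, 4],
    ![6, 2, 1, 7, 4, 3, 0, 5],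
    ![5, 3, 4, 2, 6, 0, 1, 7],
    ![1, 4, 2, 0, 7, 5, 3, 6],
    ![4, 7, 0, 1, 5, 2, 6, 3],
    ![0, 6, 3, 5, 2, 7, 4, 1],
    ![2, 1, 7, 4, 3, 6, 5, 0],
    ![3, 0, 5, 6, 1, 4, 7, 2]]

/-- The rows `q.1 < q.2.1` and columns `q.2.2.1 < q.2.2.2` cut out a `2 × 2` subsquare of `L`. -/
def IsSubsquare {n : ℕ} (L : Fin n → Fin n → Fin n) (q : Fin n × Fin n × Fin n × Fin n) : Prop :=
  q.1 < q.2.1 ∧ q.2.2.1 < q.2.2.2 ∧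
    L q.1 q.2.2.1 = L q.2.1 q.2.2.2 ∧ L q.1 q.2.2.2 = L q.2.1 q.2.2.1

instance {n : ℕ} (L : Fin n → Fin n → Fin n) : DecidablePred (IsSubsquare L) := fun q => by
  unfold IsSubsquare; infer_instance

/-- The four entries of `L` in the rows `q.1, q.2.1` and columns `q.2.2.1, q.2.2.2`. -/
def subsquareEntries {n : ℕ} (L : Fin n → Fin n → Fin n) (q : Fin n × Fin n × Fin n × Fin n) :
    Finset (Fin n × Fin n × Fin n) :=
  {(q.1, q.2.2.1, L q.1 q.2.2.1), (q.1, q.2.2.2, L q.1 q.2.2.2),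
    (q.2.1, q.2.2.1, L q.2.1 q.2.2.1), (q.2.1, q.2.2.2, L q.2.1 q.2.2.2)}

/-- The positions in which `L` and `L'` differ. -/
def diffPositions {n : ℕ} (L L' : Fin n → Fin n → Fin n) : Finset (Fin n × Fin n) :=
  Finset.univ.filter fun p => L p.1 p.2 ≠ L' p.1 p.2

theorem mem_diffPositions {n : ℕ} {L L' : Fin n → Fin n → Fin n} {i j : Fin n} :
    (i, j) ∈ diffPositions L L' ↔ L i j ≠ L' i j := by
  simp [diffPositions]

theorem exists_row_partner {n : ℕ} {L L' : Fin n → Fin n → Fin n} (hL : IsLatinSquare L)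
    (hL' : IsLatinSquare L') {i j : Fin n} (h : L i j ≠ L' i j) :
    ∃ k, k ≠ j ∧ L i k ≠ L' i k ∧ L i k = L' i j := by
  obtain ⟨k, hk⟩ := (Finite.injective_iff_surjective.mp (hL.1 i)) (L' i j)
  have hkj : k ≠ j := by rintro rfl; exact h hk
  exact ⟨k, hkj, fun e => hkj (hL'.1 i (e.symm.trans hk)), hk⟩

theorem IsLatinSquare.transpose {n : ℕ} {L : Fin n → Fin n → Fin n} (hL : IsLatinSquare L) :
    IsLatinSquare fun i j => L j i :=
  ⟨hL.2, hL.1⟩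

theorem exists_col_partner {n : ℕ} {L L' : Fin n → Fin n → Fin n} (hL : IsLatinSquare L)
    (hL' : IsLatinSquare L') {i j : Fin n} (h : L i j ≠ L' i j) :
    ∃ k, k ≠ i ∧ L k j ≠ L' k j ∧ L k j = L' i j :=
  exists_row_partner hL.transpose hL'.transpose h

/-- Two Latin squares that differ in exactly four positions differ in a `2 × 2` subsquare. -/
theorem exists_subsquare_of_card_eq_four {n : ℕ} {L L' : Fin n → Fin n → Fin n}
    (hL : IsLatinSquare L) (hL' : IsLatinSquare L') (hc : (diffPositions L L').card = 4) :
    ∃ i i' j j', i ≠ i' ∧ j ≠ j' ∧ L i j = L i' j' ∧ L i j' = L i' j ∧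
      diffPositions L L' = {(i, j), (i, j'), (i', j), (i', j')} := by
  obtain ⟨⟨i, j⟩, hij⟩ : (diffPositions L L').Nonempty := Finset.card_pos.mp (by omega)
  have h := mem_diffPositions.mp hij
  obtain ⟨j', hj, h₁, e₁⟩ := exists_row_partner hL hL' h
  obtain ⟨i', hi, h₂, e₂⟩ := exists_col_partner hL hL' h
  obtain ⟨l, hl, h₃, e₃⟩ := exists_row_partner hL hL' h₂
  obtain ⟨k, hk, h₄, e₄⟩ := exists_col_partner hL hL' h₁
  obtain ⟨m, hm, h₅, e₅⟩ := exists_row_partner hL hL' h₁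
  have hD : diffPositions L L' = {(i, j), (i, j'), (i', j), (i', l)} := by
    symm
    apply Finset.eq_of_subset_of_card_le
    · simp only [Finset.insert_subset_iff, Finset.singleton_subset_iff, mem_diffPositions]
      exact ⟨h, h₁, h₂, h₃⟩
    · rw [hc, Finset.card_insert_of_notMem, Finset.card_insert_of_notMem,
        Finset.card_pair] <;> simp [hj, hj.symm, hi.symm, hl.symm]
  have hk' := mem_diffPositions.mpr h₄
  have hm' := mem_diffPositions.mpr h₅
  simp only [hD, Finset.mem_insert, Finset.mem_singleton, Prod.mk.injEq] at hk' hm'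
  obtain ⟨rfl, rfl⟩ : k = i' ∧ j' = l := by tauto
  obtain rfl : m = j := by tauto
  exact ⟨i, k, m, j', hi.symm, hj.symm, e₅.trans e₄.symm, e₁.trans e₂.symm, hD⟩

/-- Exchange the columns `j` and `j'` of `L` within the rows `i` and `i'`. -/
def switch {n : ℕ} (L : Fin n → Fin n → Fin n) (i i' j j' r c : Fin n) : Fin n :=
  if r = i ∨ r = i' then L r (Equiv.swap j j' c) else L r c

theorem IsLatinSquare.switch {n : ℕ} {L : Fin n → Fin n → Fin n} (hL : IsLatinSquare L)
    {i i' j j' : Fin n} (h : L i j = L i' j') (h' : L i j' = L i' j) :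
    IsLatinSquare (switch L i i' j j') := by
  constructor
  · intro r c d hcd
    unfold _root_.switch at hcd
    split_ifs at hcd
    · exact (Equiv.swap j j').injective (hL.1 r hcd)
    · exact hL.1 r hcd
  · intro c
    by_cases hc : c = j ∨ c = j'
    · have key : ∀ r, _root_.switch L i i' j j' r c = L (Equiv.swap i i' r) c := by
        intro r
        unfold _root_.switch
        split_ifs with hr
        · rcases hr with rfl | rfl <;> rcases hc with rfl | rfl <;> simp [h, h']
        · push Not at hr
          rw [Equiv.swap_apply_of_ne_of_ne hr.1 hr.2]
      intro r s hrs
      simp only [key] at hrs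
      exact (Equiv.swap i i').injective (hL.2 c hrs)
    · push Not at hc
      intro r s hrs
      simp only [_root_.switch, Equiv.swap_apply_of_ne_of_ne hc.1 hc.2, ite_self] at hrs
      exact hL.2 c hrs

theorem diffPositions_switch {n : ℕ} {L : Fin n → Fin n → Fin n} (hL : IsLatinSquare L)
    {i i' j j' : Fin n} (hj : j ≠ j') :
    diffPositions L (switch L i i' j j') = {(i, j), (i, j'), (i', j), (i', j')} := by
  ext ⟨r, c⟩
  have key : L r c ≠ switch L i i' j j' r c ↔ (r = i ∨ r = i') ∧ (c = j ∨ c = j') := by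
    unfold switch
    split_ifs with hr
    · rw [(hL.1 r).ne_iff, ne_comm, Equiv.swap_apply_ne_self_iff]
      tauto
    · tauto
  simp only [mem_diffPositions, key, Finset.mem_insert, Finset.mem_singleton, Prod.mk.injEq]
  tauto

/-- The trades of size four in a Latin square are its `2 × 2` subsquares. -/
theorem isTrade_and_card_eq_four_iff {n : ℕ} {L : Fin n → Fin n → Fin n} (hL : IsLatinSquare L)
    (T : Finset (Fin n × Fin n × Fin n)) :
    IsTrade L T ∧ T.card = 4 ↔ ∃ q, IsSubsquare L q ∧ subsquareEntries L q = T := by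
  have inj : Function.Injective fun p : Fin n × Fin n => (p.1, p.2, L p.1 p.2) := by
    rintro ⟨a, b⟩ ⟨c, d⟩ h
    simp_all
  constructor
  · rintro ⟨⟨L', hL', -, rfl⟩, hc⟩
    change ((diffPositions L L').image _).card = 4 at hc
    change ∃ q, _ ∧ _ = (diffPositions L L').image _
    rw [Finset.card_image_of_injective _ inj] at hc
    obtain ⟨i, i', j, j', hi, hj, e, e', hD⟩ := exists_subsquare_of_card_eq_four hL hL' hc
    rw [hD]
    rcases hi.lt_or_gt with hi | hi <;> rcases hj.lt_or_gt with hj | hj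
    · refine ⟨(i, i', j, j'), ⟨hi, hj, e, e'⟩, ?_⟩
      ext; simp [subsquareEntries]
    · refine ⟨(i, i', j', j), ⟨hi, hj, e', e⟩, ?_⟩
      ext; simp [subsquareEntries]; tauto
    · refine ⟨(i', i, j, j'), ⟨hi, hj, e'.symm, e.symm⟩, ?_⟩
      ext; simp [subsquareEntries]; tauto
    · refine ⟨(i', i, j', j), ⟨hi, hj, e.symm, e'.symm⟩, ?_⟩
      ext; simp [subsquareEntries]; tauto
  · rintro ⟨⟨i, i', j, j'⟩, ⟨hi, hj, e, e'⟩, rfl⟩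
    dsimp only at hi hj e e'
    have hD := diffPositions_switch hL (i := i) (i' := i') hj.ne
    refine ⟨⟨switch L i i' j j', hL.switch e e', ?_, ?_⟩, ?_⟩
    · intro hs
      have hmem : (i, j) ∈ diffPositions L (switch L i i' j j') := by simp [hD]
      exact mem_diffPositions.mp hmem (by rw [hs])
    · change _ = (diffPositions L (switch L i i' j j')).image _
      rw [hD]
      simp [subsquareEntries, Finset.image_insert]
    · unfold subsquareEntries
      rw [Finset.card_insert_of_notMem, Finset.card_insert_of_notMem, Finset.card_pair] <;>
        simp [hi.ne, hj.ne]

theorem isLatinSquare_W : IsLatinSquare W := by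
  unfold IsLatinSquare Function.Injective
  decide +kernel

/-- The Latin square `W` contains exactly 9 intercalates (Latin trades of size 4). -/
theorem W_intercalates :
    Nat.card {T : Finset (Fin 8 × Fin 8 × Fin 8) // IsTrade W T ∧ T.card = 4} = 9 := by
  rw [Nat.subtype_card ((Finset.univ.filter (IsSubsquare W)).image (subsquareEntries W))
    fun T => by simp [isTrade_and_card_eq_four_iff isLatinSquare_W]]
  decide +kernel
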